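/- Let n ≥ 2 and 0 < r₀ < 1. Let u and v be real-valued functions that are continuous on the closed annulus {x ∈ ℝⁿ : r₀ ≤ |x| ≤ 1} and harmonic on the open annulus A(r₀,1) = {x ∈ ℝⁿ : r₀ < |x| < 1}, with v radial (v(x) = g(|x|) for some g), and assume ∫_{|x|=1} (u − v) dσ = 0 and ∫_{|x|=r₀} (u − v) dσ = 0. Then Λ_{A(r₀,1)}(v) ≤ C · Λ_{A(r₀,1)}(u), where C > 0 is a constant independent of u, v, and r₀. -/

import Mathlib

open MeasureTheory Filter Set ENNReal

noncomputable section

/-- A function is harmonic on an open set `U ⊆ ℝⁿ` if it is twice continuously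
differentiable there and its Laplacian (the sum of second partial derivatives)
vanishes on `U`. -/
def IsHarmonicOn {n : ℕ} (u : EuclideanSpace ℝ (Fin n) → ℝ)
    (U : Set (EuclideanSpace ℝ (Fin n))) : Prop :=
  ContDiffOn ℝ 2 u U ∧
    ∀ x ∈ U,
      (∑ i : Fin n,
        fderiv ℝ (fun y => fderiv ℝ u y (EuclideanSpace.single i (1 : ℝ))) x
          (EuclideanSpace.single i (1 : ℝ))) = 0

/-- `Λ_Ω(g) = ∫₀^∞ (L {x ∈ Ω : |g x| > λ})^{1/2} dλ`, a quantity comparable to the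
Lorentz norm `‖g‖_{L^{2,1}(Ω)}`. -/
def Lam {n : ℕ} (Ω : Set (EuclideanSpace ℝ (Fin n)))
    (g : EuclideanSpace ℝ (Fin n) → ℝ) : ℝ≥0∞ :=
  ∫⁻ l in Set.Ioi (0 : ℝ), (volume {x | x ∈ Ω ∧ l < |g x|}) ^ ((1 : ℝ) / 2)

abbrev EE (n : ℕ) := EuclideanSpace ℝ (Fin n)

abbrev GG (n : ℕ) := ↥(unitary (EE n →L[ℝ] EE n))

theorem exists_rot (n : ℕ) : ∃ (G : Type) (_ : MeasurableSpace G) (μ : Measure G)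
    (ρ : G → (EuclideanSpace ℝ (Fin n) ≃ₗᵢ[ℝ] EuclideanSpace ℝ (Fin n))),
    IsProbabilityMeasure μ ∧ Measurable (fun p : G × EuclideanSpace ℝ (Fin n) => ρ p.1 p.2) ∧
    ∀ x y : EuclideanSpace ℝ (Fin n), ‖x‖ = ‖y‖ → μ.map (fun g => ρ g x) = μ.map (fun g => ρ g y) := by
  let : MeasurableSpace (GG n) := borel (GG n)
  have : BorelSpace (GG n) := ⟨rfl⟩
  have : ProperSpace ((EE n) →L[ℝ] (EE n)) := FiniteDimensional.proper ℝ _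
  have : ContinuousStar (EE n →L[ℝ] EE n) := ⟨(ContinuousLinearMap.adjoint (𝕜 := ℝ) (E := EE n) (F := EE n)).continuous⟩
  have : IsTopologicalGroup (GG n) := inferInstance
  have : CompactSpace (GG n) := by
    refine isCompact_iff_compactSpace.1 ?_
    apply Metric.isCompact_of_isClosed_isBounded
    · exact isClosed_unitary
    · refine (Metric.isBounded_closedBall (x := (0 : (EE n) →L[ℝ] (EE n))) (r := 1)).subset ?_
      intro U hU
      rw [mem_closedBall_zero_iff]
      refine ContinuousLinearMap.opNorm_le_bound _ zero_le_one fun x => ?_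
      have := (Unitary.linearIsometryEquiv ⟨U, hU⟩).norm_map x
      rw [one_mul]
      exact this.le
  have : SecondCountableTopology (GG n) := inferInstance
  let ν : Measure (GG n) := (Measure.haarMeasure (⊤ : TopologicalSpace.PositiveCompacts (GG n))).inv
  have : ν.IsMulRightInvariant := inferInstance
  have hν : IsProbabilityMeasure ν := by
    constructor
    simp only [ν]
    rw [Measure.inv_apply, Set.inv_univ]
    exact Measure.haarMeasure_self
  have hc : Continuous (fun p : (GG n) × (EE n) => Unitary.linearIsometryEquiv p.1 p.2) := by
    have : (fun p : (GG n) × (EE n) => Unitary.linearIsometryEquiv p.1 p.2) = fun p : (GG n) × (EE n) => (p.1 : (EE n) →L[ℝ] (EE n)) p.2 := by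
      ext p; rfl
    rw [this]
    fun_prop
  refine ⟨(GG n), inferInstance, ν, fun g => Unitary.linearIsometryEquiv g, hν, hc.measurable, ?_⟩
  intro x y hxy
  obtain ⟨k, hk⟩ : ∃ k : (GG n), Unitary.linearIsometryEquiv k x = y := by
    refine ⟨Unitary.linearIsometryEquiv.symm (Submodule.reflection (ℝ ∙ (x - y))ᗮ), ?_⟩
    rw [MulEquiv.apply_symm_apply]
    exact Submodule.reflection_sub hxy
  have hcx : Measurable (fun g : (GG n) => Unitary.linearIsometryEquiv g x) :=
    (hc.comp (Continuous.prodMk continuous_id continuous_const)).measurable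
  have h2 : (fun g : (GG n) => Unitary.linearIsometryEquiv g y) =
     (fun g : (GG n) => Unitary.linearIsometryEquiv g x) ∘ (fun g : (GG n) => g * k) := by
    funext g
    simp [← hk]
  rw [h2, ← Measure.map_map hcx (measurable_mul_const k), map_mul_right_eq_self]

theorem lin_inv_sq (c : ℝ) (hc : 0 < c) :
    ∫⁻ s in Ioi c, ENNReal.ofReal (s ^ (-2 : ℝ)) = ENNReal.ofReal c⁻¹ := by
  rw [← ofReal_integral_eq_lintegral_ofReal (integrableOn_Ioi_rpow_of_lt (by norm_num) hc),
    integral_Ioi_rpow_of_lt (by norm_num) hc]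
  · congr 1
    have : (-2 : ℝ) + 1 = -1 := by norm_num
    rw [this, Real.rpow_neg_one]; simp
  · filter_upwards [ae_restrict_mem measurableSet_Ioi] with s hs
    exact Real.rpow_nonneg (hc.le.trans (le_of_lt hs)) _

/-- weak L2 implies the bound -/
theorem weak_bound {X : Type*} [MeasurableSpace X] (μ : Measure X) [IsFiniteMeasure μ]
    (h : X → ℝ≥0∞) (hm : Measurable h)
    (hw : ∀ s : ℝ, 0 < s → μ {x | ENNReal.ofReal s < h x} ≤ ENNReal.ofReal (s ^ (-2 : ℝ)))
    (F : Set X) :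
    ∫⁻ x in F, h x ∂μ ≤ 2 * μ F ^ ((1 : ℝ) / 2) := by
  by_cases hF0 : μ F = 0
  · rw [setLIntegral_measure_zero _ _ hF0]; exact zero_le
  have hfin : μ F ≠ ⊤ := measure_ne_top _ _
  have htop : μ {x | h x = ⊤} = 0 := by
    have h1 : ∀ s : ℝ, 0 < s → μ {x | h x = ⊤} ≤ ENNReal.ofReal (s ^ (-2 : ℝ)) := fun s hs =>
      (measure_mono (fun x (hx : h x = ⊤) => by simp [hx])).trans (hw s hs)
    have h2 : Tendsto (fun s : ℝ => ENNReal.ofReal (s ^ (-2 : ℝ))) atTop (nhds 0) := by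
      have := ENNReal.tendsto_ofReal (tendsto_rpow_neg_atTop (y := 2) (by norm_num))
      simpa using this
    have := ge_of_tendsto h2 ((eventually_gt_atTop 0).mono h1)
    simpa using this
  have hae : ∀ᵐ x ∂(μ.restrict F), h x = ENNReal.ofReal (h x).toReal := by
    apply ae_restrict_of_ae
    have : ∀ᵐ x ∂μ, h x ≠ ⊤ := by
      rw [ae_iff]; simpa using htop
    filter_upwards [this] with x hx
    rw [ENNReal.ofReal_toReal hx]
  rw [lintegral_congr_ae hae, lintegral_eq_lintegral_meas_lt _
    (Eventually.of_forall fun x => ENNReal.toReal_nonneg) hm.ennreal_toReal.aemeasurable]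
  set m : ℝ := (μ F).toReal with hmdef
  have hm0 : 0 < m := ENNReal.toReal_pos hF0 hfin
  have hmF : μ F = ENNReal.ofReal m := (ENNReal.ofReal_toReal hfin).symm
  set c : ℝ := m ^ (-(1/2) : ℝ) with hcdef
  have hc0 : 0 < c := Real.rpow_pos_of_pos hm0 _
  have hmc : m * c = m ^ ((1 : ℝ)/2) := by
    rw [hcdef]; nth_rewrite 1 [← Real.rpow_one m]; rw [← Real.rpow_add hm0]; norm_num
  have hci : c⁻¹ = m ^ ((1 : ℝ)/2) := by
    rw [hcdef, Real.rpow_neg hm0.le, inv_inv]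
  have hsplit : Ioi (0 : ℝ) = Ioc 0 c ∪ Ioi c := (Ioc_union_Ioi_eq_Ioi hc0.le).symm
  rw [hsplit]
  refine (lintegral_union_le _ _ _).trans ?_
  have e1 : ∫⁻ t in Ioc 0 c, (μ.restrict F) {a | t < (h a).toReal} ≤ ENNReal.ofReal (m ^ ((1:ℝ)/2)) := by
    calc _ ≤ ∫⁻ t in Ioc 0 c, μ F := by
          apply lintegral_mono
          intro t
          exact (measure_mono (subset_univ _)).trans (by simp)
      _ = ENNReal.ofReal (m ^ ((1:ℝ)/2)) := by
          rw [setLIntegral_const, Real.volume_Ioc, sub_zero, hmF, ← ENNReal.ofReal_mul hm0.le, hmc]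
  have e2 : ∫⁻ t in Ioi c, (μ.restrict F) {a | t < (h a).toReal} ≤ ENNReal.ofReal (m ^ ((1:ℝ)/2)) := by
    calc _ ≤ ∫⁻ t in Ioi c, ENNReal.ofReal (t ^ (-2 : ℝ)) := by
          apply setLIntegral_mono' measurableSet_Ioi
          intro t ht
          refine (Measure.restrict_apply_le _ _).trans ((measure_mono ?_).trans (hw t (hc0.trans ht)))
          intro x hx
          simp only [mem_ofPred_eq] at hx ⊢
          rw [ENNReal.ofReal_lt_iff_lt_toReal (hc0.trans ht).le]
          · exact hx
          · intro hh; rw [hh] at hx; simp at hx; exact absurd (hc0.trans ht) (not_lt.2 hx.le)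
      _ = _ := by rw [lin_inv_sq c hc0, hci]
  calc _ ≤ _ := add_le_add e1 e2
    _ = _ := by
      rw [hmF, ENNReal.ofReal_rpow_of_pos hm0, two_mul]

/-- the weight -/
def wt {X : Type*} [MeasurableSpace X] (μ : Measure X) (a : X → ℝ) (t : ℝ) : ℝ≥0∞ :=
  (μ {y | t ≤ a y}) ^ (-(1/2) : ℝ)

theorem wt_mono {X : Type*} [MeasurableSpace X] (μ : Measure X) (a : X → ℝ) : Monotone (wt μ a) := by
  intro s t hst
  unfold wt
  rw [ENNReal.rpow_neg, ENNReal.rpow_neg]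
  apply ENNReal.inv_le_inv.2
  apply ENNReal.rpow_le_rpow _ (by norm_num)
  exact measure_mono fun y hy => hst.trans hy

theorem wt_weak {X : Type*} [MeasurableSpace X] (μ : Measure X) [IsFiniteMeasure μ] (a : X → ℝ)
    (s : ℝ) (hs : 0 < s) : 
    μ {x | ENNReal.ofReal s < wt μ a (a x)} ≤ ENNReal.ofReal (s ^ (-2 : ℝ)) := by
  set A := ENNReal.ofReal (s ^ (-2 : ℝ))
  have key : ∀ t, ENNReal.ofReal s < wt μ a t → μ {y | t ≤ a y} ≤ A := by
    intro t ht
    unfold wt at ht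
    by_contra hcon
    push Not at hcon
    have : (μ {y | t ≤ a y}) ^ (-(1/2) : ℝ) ≤ A ^ (-(1/2) : ℝ) := by
      rw [ENNReal.rpow_neg, ENNReal.rpow_neg]
      exact ENNReal.inv_le_inv.2 (ENNReal.rpow_le_rpow hcon.le (by norm_num))
    have h2 : A ^ (-(1/2) : ℝ) = ENNReal.ofReal s := by
      rw [ENNReal.ofReal_rpow_of_pos (Real.rpow_pos_of_pos hs _), ← Real.rpow_mul hs.le]
      norm_num
    rw [h2] at this
    exact absurd ht (not_lt.2 this)
  -- the set T of good levels is an upper set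
  set T : Set ℝ := {t | ENNReal.ofReal s < wt μ a t} with hT
  have hup : ∀ t ∈ T, ∀ t', t ≤ t' → t' ∈ T := fun t ht t' h => lt_of_lt_of_le ht (wt_mono μ a h)
  by_cases hne : T.Nonempty
  swap
  · rw [not_nonempty_iff_eq_empty] at hne
    have : {x | ENNReal.ofReal s < wt μ a (a x)} = ∅ := by
      ext x; simp only [mem_ofPred_eq, mem_empty_iff_false, iff_false]
      intro hx
      have : a x ∈ T := hx
      rw [hne] at this; exact this
    rw [this]; simp
  by_cases hb : BddBelow T
  · by_cases hmem : sInf T ∈ T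
    · refine (measure_mono ?_).trans (key _ hmem)
      intro x hx
      exact csInf_le hb hx
    · obtain ⟨w, -, hwl, hw⟩ := exists_seq_strictAnti_tendsto (sInf T)
      have hwT : ∀ k, w k ∈ T := by
        intro k
        obtain ⟨t, ht, htw⟩ := exists_lt_of_csInf_lt hne (hwl k)
        exact hup t ht _ htw.le
      have hsub : {x | ENNReal.ofReal s < wt μ a (a x)} ⊆ ⋃ k, {y | w k ≤ a y} := by
        intro x hx
        have h1 : sInf T < a x := lt_of_le_of_ne (csInf_le hb hx) (fun h => hmem (h ▸ hx))
        obtain ⟨k, hk⟩ := (hw.eventually (gt_mem_nhds h1)).exists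
        exact mem_iUnion.2 ⟨k, le_of_lt hk⟩
      refine (measure_mono hsub).trans ?_
      rw [Directed.measure_iUnion]
      · exact iSup_le fun k => key _ (hwT k)
      · intro i j
        rcases le_total (w i) (w j) with h | h
        · exact ⟨i, Subset.rfl, fun y hy => h.trans hy⟩
        · exact ⟨j, fun y hy => h.trans hy, Subset.rfl⟩
  · have hwT : ∀ k : ℕ, -(k : ℝ) ∈ T := by
      intro k
      rw [not_bddBelow_iff] at hb
      obtain ⟨t, ht, h⟩ := hb (-(k:ℝ))
      exact hup t ht _ h.le
    have hsub : {x | ENNReal.ofReal s < wt μ a (a x)} ⊆ ⋃ k : ℕ, {y | -(k:ℝ) ≤ a y} := by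
      intro x hx
      obtain ⟨k, hk⟩ := exists_nat_ge (-(a x))
      exact mem_iUnion.2 ⟨k, by simp only [mem_ofPred_eq]; linarith⟩
    refine (measure_mono hsub).trans ?_
    rw [Directed.measure_iUnion]
    · exact iSup_le fun k => key _ (hwT k)
    · intro i j
      refine ⟨max i j, fun y (hy : -(i:ℝ) ≤ a y) => ?_, fun y (hy : -(j:ℝ) ≤ a y) => ?_⟩
      all_goals 
        simp only [mem_ofPred_eq]; push_cast
        linarith [le_max_left (i:ℝ) j, le_max_right (i:ℝ) j]

theorem lorentz_core {X : Type*} [MeasurableSpace X] (μ : Measure X) [IsFiniteMeasure μ]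
    (a b : X → ℝ) (ha : Measurable a) (hb : Measurable b) (ha0 : ∀ x, 0 ≤ a x) (hb0 : ∀ x, 0 ≤ b x)
    (hab : ∫⁻ x, ENNReal.ofReal (a x) * wt μ a (a x) ∂μ ≤ ∫⁻ x, ENNReal.ofReal (b x) * wt μ a (a x) ∂μ) :
    ∫⁻ l in Ioi (0:ℝ), μ {x | l < a x} ^ ((1:ℝ)/2) ≤ 
      2 * ∫⁻ l in Ioi (0:ℝ), μ {x | l < b x} ^ ((1:ℝ)/2) := by
  have hwm : Measurable (fun x => wt μ a (a x)) := (wt_mono μ a).measurable.comp ha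
  set ν := μ.withDensity (fun x => wt μ a (a x)) with hν
  have ea : ∫⁻ x, ENNReal.ofReal (a x) * wt μ a (a x) ∂μ = ∫⁻ l in Ioi (0:ℝ), ν {x | l < a x} := by
    rw [← lintegral_eq_lintegral_meas_lt ν (Eventually.of_forall ha0) ha.aemeasurable, hν,
      lintegral_withDensity_eq_lintegral_mul _ hwm ha.ennreal_ofReal]
    simp [mul_comm]
  have eb : ∫⁻ x, ENNReal.ofReal (b x) * wt μ a (a x) ∂μ = ∫⁻ l in Ioi (0:ℝ), ν {x | l < b x} := by
    rw [← lintegral_eq_lintegral_meas_lt ν (Eventually.of_forall hb0) hb.aemeasurable, hν,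
      lintegral_withDensity_eq_lintegral_mul _ hwm hb.ennreal_ofReal]
    simp [mul_comm]
  calc ∫⁻ l in Ioi (0:ℝ), μ {x | l < a x} ^ ((1:ℝ)/2) ≤ ∫⁻ l in Ioi (0:ℝ), ν {x | l < a x} := by
        apply lintegral_mono
        intro l
        have hml : MeasurableSet {x | l < a x} := measurableSet_lt measurable_const ha
        simp only
        rw [hν, withDensity_apply _ hml]
        by_cases h0 : μ {x | l < a x} = 0
        · rw [h0, ENNReal.zero_rpow_of_pos (by norm_num)]; exact zero_le
        calc μ {x | l < a x} ^ ((1:ℝ)/2) = μ {x | l < a x} ^ (-(1/2):ℝ) * μ {x | l < a x} := by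
              nth_rewrite 3 [← ENNReal.rpow_one (μ {x | l < a x})]
              rw [← ENNReal.rpow_add _ _ h0 (measure_ne_top _ _)]
              norm_num
          _ = ∫⁻ x in {x | l < a x}, μ {x | l < a x} ^ (-(1/2):ℝ) ∂μ := by rw [setLIntegral_const]
          _ ≤ _ := by
              apply setLIntegral_mono' hml
              intro x hx
              unfold wt
              rw [ENNReal.rpow_neg, ENNReal.rpow_neg]
              exact ENNReal.inv_le_inv.2 (ENNReal.rpow_le_rpow (measure_mono fun y (hy : a x ≤ a y) => show l < a y from lt_of_lt_of_le hx hy) (by norm_num))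
    _ ≤ ∫⁻ l in Ioi (0:ℝ), ν {x | l < b x} := by rw [← ea, ← eb]; exact hab
    _ ≤ ∫⁻ l in Ioi (0:ℝ), 2 * μ {x | l < b x} ^ ((1:ℝ)/2) := by
        apply lintegral_mono
        intro l
        have hml : MeasurableSet {x | l < b x} := measurableSet_lt measurable_const hb
        simp only
        rw [hν, withDensity_apply _ hml]
        exact weak_bound μ _ hwm (wt_weak μ a) _
    _ = _ := lintegral_const_mul' _ _ (by norm_num)

theorem sphere_pos (m : ℕ) (r : ℝ) (hr : 0 < r) :
    0 < μH[(m:ℝ)] (Metric.sphere (0 : EuclideanSpace ℝ (Fin (m+1))) r) := by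
  let P : EuclideanSpace ℝ (Fin (m+1)) → (Fin m → ℝ) := fun x i => x i.succ
  have hP : LipschitzWith 1 P := by
    apply LipschitzWith.of_dist_le_mul
    intro x y
    rw [NNReal.coe_one, one_mul, dist_pi_le_iff dist_nonneg]
    intro i
    rw [EuclideanSpace.dist_eq]
    apply Real.le_sqrt_of_sq_le
    exact Finset.single_le_sum (f := fun i => dist (x i) (y i) ^ 2) (fun i _ => sq_nonneg _) (Finset.mem_univ i.succ)
  set δ : ℝ := r / (m+1) with hδ
  have hδ0 : 0 < δ := by positivity
  have hsub : Metric.ball (0 : Fin m → ℝ) δ ⊆ P '' (Metric.sphere (0 : EuclideanSpace ℝ (Fin (m+1))) r) := by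
    intro y hy
    rw [mem_ball_zero_iff, pi_norm_lt_iff hδ0] at hy
    have hle : ∑ i, y i ^ 2 ≤ r ^ 2 := by
      have h1 : ∀ i ∈ Finset.univ, y i ^ 2 ≤ δ ^ 2 := fun i _ => by
        have := hy i
        rw [Real.norm_eq_abs] at this
        exact sq_le_sq' (abs_lt.1 this).1.le (abs_lt.1 this).2.le
      refine (Finset.sum_le_card_nsmul _ _ _ h1).trans ?_
      simp only [Finset.card_univ, Fintype.card_fin, nsmul_eq_mul, hδ]
      rw [div_pow, mul_div_assoc', div_le_iff₀ (by positivity)]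
      have : (m:ℝ) ≤ (m+1)^2 := by nlinarith [(Nat.cast_nonneg m : (0:ℝ) ≤ m)]
      nlinarith [sq_nonneg r]
    refine ⟨WithLp.toLp 2 (Fin.cons (Real.sqrt (r^2 - ∑ i, y i ^ 2)) y), ?_, ?_⟩
    · rw [mem_sphere_zero_iff_norm, EuclideanSpace.norm_eq, Fin.sum_univ_succ]
      simp only [Fin.cons_zero, Fin.cons_succ, Real.norm_eq_abs, sq_abs]
      rw [Real.sq_sqrt (by linarith), sub_add_cancel, Real.sqrt_sq hr.le]
    · ext i; simp [P]
  have h1 := hP.hausdorffMeasure_image_le (d := (m:ℝ)) (Nat.cast_nonneg m) (Metric.sphere (0 : EuclideanSpace ℝ (Fin (m+1))) r)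
  have h2 : (μH[(m:ℝ)] : Measure (Fin m → ℝ)) = volume := by
    have := hausdorffMeasure_pi_real (ι := Fin m)
    rwa [Fintype.card_fin] at this
  simp only [ENNReal.coe_one, ENNReal.one_rpow, one_mul] at h1
  refine lt_of_lt_of_le ?_ h1
  refine lt_of_lt_of_le ?_ (measure_mono hsub)
  rw [h2]
  exact Metric.measure_ball_pos _ _ hδ0

theorem sphere_fin (m : ℕ) (r : ℝ) (hr : 0 < r) :
    μH[(m:ℝ)] (Metric.sphere (0 : EuclideanSpace ℝ (Fin (m+1))) r) < ⊤ := by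
  have h2 : (μH[(m:ℝ)] : Measure (Fin m → ℝ)) = volume := by
    have := hausdorffMeasure_pi_real (ι := Fin m)
    rwa [Fintype.card_fin] at this
  let z : Fin (m+1) × Bool → (Fin m → ℝ) → EuclideanSpace ℝ (Fin (m+1)) := fun p y =>
    WithLp.toLp 2 (Fin.insertNth p.1 (if p.2 then (1:ℝ) else -1) y)
  let Φ : Fin (m+1) × Bool → (Fin m → ℝ) → EuclideanSpace ℝ (Fin (m+1)) := fun p y =>
    (r / ‖z p y‖) • z p y
  have hz0 : ∀ p y, z p y ≠ 0 := by
    intro p y h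
    have := congrArg (fun w : EuclideanSpace ℝ (Fin (m+1)) => w p.1) h
    simp [z] at this
    split_ifs at this <;> norm_num at this
  have hz : ∀ p, ContDiff ℝ 1 (z p) := by
    intro p
    rw [contDiff_euclidean]
    intro i
    simp only [z]
    refine Fin.succAboveCases p.1 ?_ (fun j => ?_) i
    · simp only [Fin.insertNth_apply_same]; exact contDiff_const
    · simp only [Fin.insertNth_apply_succAbove]; exact contDiff_apply ℝ ℝ j
  have hΦ : ∀ p, ContDiff ℝ 1 (Φ p) := by
    intro p
    exact (contDiff_const.div ((hz p).norm ℝ (hz0 p)) (fun y => norm_ne_zero_iff.2 (hz0 p y))).smul (hz p)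
  have hK : IsCompact (Metric.closedBall (0 : Fin m → ℝ) 1) := isCompact_closedBall _ _
  have hfin : ∀ p, μH[(m:ℝ)] (Φ p '' Metric.closedBall 0 1) < ⊤ := by
    intro p
    obtain ⟨K, hKL⟩ := LocallyLipschitzOn.exists_lipschitzOnWith_of_compact hK ((hΦ p).locallyLipschitz.locallyLipschitzOn)
    refine (hKL.hausdorffMeasure_image_le (Nat.cast_nonneg m)).trans_lt ?_
    rw [h2]
    exact ENNReal.mul_lt_top (ENNReal.rpow_lt_top_of_nonneg (Nat.cast_nonneg m) (by simp)) hK.measure_lt_top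
  have hsub : Metric.sphere (0 : EuclideanSpace ℝ (Fin (m+1))) r ⊆ ⋃ p, Φ p '' Metric.closedBall 0 1 := by
    intro x hx
    rw [mem_sphere_zero_iff_norm] at hx
    obtain ⟨i, -, hi⟩ := Finset.exists_max_image Finset.univ (fun i => |x i|) Finset.univ_nonempty
    have hxi : 0 < |x i| := by
      rw [abs_pos]
      intro h0
      have : x = 0 := by
        ext j
        have := hi j (Finset.mem_univ j)
        rw [h0, abs_zero] at this
        simpa using this
      rw [this, norm_zero] at hx
      linarith
    have hxz : z (i, decide (0 < x i)) (fun j => x (i.succAbove j) / |x i|) = |x i|⁻¹ • x := by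
      ext k
      refine Fin.succAboveCases i ?_ (fun j => ?_) k
      · simp only [z, Fin.insertNth_apply_same, decide_eq_true_eq, PiLp.smul_apply, smul_eq_mul]
        split_ifs with h
        · rw [abs_of_pos h, inv_mul_cancel₀ h.ne']
        · have h' : x i < 0 := lt_of_le_of_ne (not_lt.1 h) (abs_pos.1 hxi)
          rw [abs_of_neg h', inv_neg, neg_mul, inv_mul_cancel₀ h'.ne]
      · simp only [z, Fin.insertNth_apply_succAbove, PiLp.smul_apply, smul_eq_mul]
        field_simp
    refine mem_iUnion.2 ⟨(i, decide (0 < x i)), fun j => x (i.succAbove j) / |x i|, ?_, ?_⟩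
    · rw [mem_closedBall_zero_iff, pi_norm_le_iff_of_nonneg zero_le_one]
      intro j
      rw [Real.norm_eq_abs, abs_div, abs_abs, div_le_one hxi]
      exact hi _ (Finset.mem_univ _)
    · simp only [Φ]
      rw [hxz, norm_smul, hx, smul_smul, norm_inv, Real.norm_eq_abs, abs_abs]
      have : r / (|x i|⁻¹ * r) * |x i|⁻¹ = 1 := by field_simp
      rw [this, one_smul]
  refine (measure_mono hsub).trans_lt ?_
  refine (measure_iUnion_fintype_le _ _).trans_lt ?_
  exact ENNReal.sum_lt_top.2 fun p _ => hfin p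

theorem dir_diff {E : Type*} [NormedAddCommGroup E] [NormedSpace ℝ E] (f : E → ℝ) (y b : E) (hb : ‖b‖ = 1)
    (P : E → E →L[ℝ] ℝ) (κ h : ℝ) (hh : 0 < h) 
    (h1 : ∀ z, ‖z - y‖ ≤ h → DifferentiableAt ℝ f z)
    (h2 : ∀ z, ‖z - y‖ ≤ h → HasFDerivAt (fun w => fderiv ℝ f w b) (P z) z)
    (h3 : ∀ z, ‖z - y‖ ≤ h → |P z b - P y b| ≤ κ) :
    h^2 * P y b - 2 * κ * h^2 ≤ f (y + h • b) + f (y - h • b) - 2 * f y := by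
  have hκ : 0 ≤ κ := by
    have := h3 y (by simpa using hh.le)
    simpa using this
  have hp : ∀ t ∈ Icc (0:ℝ) h, ‖(y + t • b) - y‖ ≤ h := by
    intro t ht; rw [add_sub_cancel_left, norm_smul, hb, mul_one, Real.norm_eq_abs, abs_of_nonneg ht.1]; exact ht.2
  have hm : ∀ t ∈ Icc (0:ℝ) h, ‖(y - t • b) - y‖ ≤ h := by
    intro t ht; rw [sub_sub_cancel_left, norm_neg, norm_smul, hb, mul_one, Real.norm_eq_abs, abs_of_nonneg ht.1]; exact ht.2
  have lp : ∀ t : ℝ, HasDerivAt (fun t : ℝ => y + t • b) b t := fun t => by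
    simpa using ((hasDerivAt_id t).smul_const b).const_add y
  have lm : ∀ t : ℝ, HasDerivAt (fun t : ℝ => y - t • b) (-b) t := fun t => by
    simpa using ((hasDerivAt_id t).smul_const b).const_sub y
  let ψ : ℝ → ℝ := fun t => f (y + t • b) + f (y - t • b) - t^2 * P y b
  let ψ1 : ℝ → ℝ := fun t => fderiv ℝ f (y + t • b) b - fderiv ℝ f (y - t • b) b - 2 * t * P y b
  have d1 : ∀ t ∈ Icc (0:ℝ) h, HasDerivAt ψ (ψ1 t) t := by
    intro t ht
    have a1 := (h1 _ (hp t ht)).hasFDerivAt.comp_hasDerivAt t (lp t)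
    have a2 := (h1 _ (hm t ht)).hasFDerivAt.comp_hasDerivAt t (lm t)
    have a3 := ((hasDerivAt_id t).pow 2).mul_const (P y b)
    have := (a1.add a2).sub a3
    refine this.congr_deriv ?_
    simp [ψ1]; ring
  have d2 : ∀ t ∈ Icc (0:ℝ) h, HasDerivAt ψ1 (P (y + t • b) b + P (y - t • b) b - 2 * P y b) t := by
    intro t ht
    have a1 := (h2 _ (hp t ht)).comp_hasDerivAt t (lp t)
    have a2 := (h2 _ (hm t ht)).comp_hasDerivAt t (lm t)
    have a3 := (((hasDerivAt_id t).const_mul 2)).mul_const (P y b)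
    have := (a1.sub a2).sub a3
    refine this.congr_deriv ?_
    simp
  have b2 : ∀ t ∈ Icc (0:ℝ) h, ‖ψ1 t‖ ≤ 2 * κ * h := by
    intro t ht
    have := Convex.norm_image_sub_le_of_norm_hasDerivWithin_le (C := 2 * κ) (s := Icc 0 h) (x := 0) (y := t)
      (fun s hs => (d2 s hs).hasDerivWithinAt) (fun s hs => ?_) (convex_Icc 0 h) (left_mem_Icc.2 hh.le) ht
    · have h0 : ψ1 0 = 0 := by simp [ψ1]
      rw [h0, sub_zero, sub_zero, Real.norm_eq_abs t, abs_of_nonneg ht.1] at this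
      exact this.trans (mul_le_mul_of_nonneg_left ht.2 (by positivity))
    · have e1 := abs_le.1 (h3 _ (hp s hs))
      have e2 := abs_le.1 (h3 _ (hm s hs))
      rw [Real.norm_eq_abs, abs_le]
      constructor <;> linarith [e1.1, e1.2, e2.1, e2.2]
  have := Convex.norm_image_sub_le_of_norm_hasDerivWithin_le (C := 2 * κ * h) (s := Icc 0 h) (x := 0) (y := h)
      (fun s hs => (d1 s hs).hasDerivWithinAt) b2 (convex_Icc 0 h) (left_mem_Icc.2 hh.le) (right_mem_Icc.2 hh.le)
  rw [sub_zero, Real.norm_eq_abs, Real.norm_eq_abs, abs_of_pos hh] at this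
  have := (abs_le.1 this).1
  simp only [ψ, zero_smul, add_zero, sub_zero] at this
  nlinarith [this]

theorem second_diff {n : ℕ} (f : EuclideanSpace ℝ (Fin n) → ℝ) (U K : Set (EuclideanSpace ℝ (Fin n)))
    (hU : IsOpen U) (hf : IsHarmonicOn f U) (hK : IsCompact K) (hKU : K ⊆ U) (η : ℝ) (hη : 0 < η) :
    ∃ h0 > 0, ∀ h, 0 < h → h < h0 → ∀ y ∈ K, ∀ b : OrthonormalBasis (Fin n) ℝ (EuclideanSpace ℝ (Fin n)),
      -(η * h^2) ≤ ∑ i, (f (y + h • b i) + f (y - h • b i) - 2 * f y) := by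
  obtain ⟨hC, hL⟩ := hf
  have hdiff : ∀ z ∈ U, DifferentiableAt ℝ f z := fun z hz =>
    (hC.contDiffAt (hU.mem_nhds hz)).differentiableAt (by norm_num)
  have hC1 : ContDiffOn ℝ 1 (fderiv ℝ f) U := hC.fderiv_of_isOpen hU (by norm_num)
  have hdiff2 : ∀ z ∈ U, DifferentiableAt ℝ (fderiv ℝ f) z := fun z hz =>
    (hC1.contDiffAt (hU.mem_nhds hz)).differentiableAt (by norm_num)
  have hC0 : ContinuousOn (fderiv ℝ (fderiv ℝ f)) U := hC1.continuousOn_fderiv_of_isOpen hU (by norm_num)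
  have hder : ∀ z ∈ U, ∀ c, HasFDerivAt (fun w => fderiv ℝ f w c) ((fderiv ℝ (fderiv ℝ f) z).flip c) z := by
    intro z hz c
    refine ((hdiff2 z hz).hasFDerivAt.clm_apply (hasFDerivAt_const c z)).congr_fderiv ?_
    ext w; simp
  have htr : ∀ y ∈ U, ∀ b : OrthonormalBasis (Fin n) ℝ (EuclideanSpace ℝ (Fin n)), 
      ∑ i, fderiv ℝ (fderiv ℝ f) y (b i) (b i) = 0 := by
    intro y hy b
    have e : ∀ c : OrthonormalBasis (Fin n) ℝ (EuclideanSpace ℝ (Fin n)), 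
      Laplacian.laplacian f y = ∑ i, fderiv ℝ (fderiv ℝ f) y (c i) (c i) := by
      intro c
      rw [InnerProductSpace.laplacian_eq_iteratedFDeriv_orthonormalBasis f c]
      simp [iteratedFDeriv_two_apply]
    rw [← e b, e (EuclideanSpace.basisFun (Fin n) ℝ), ← hL y hy]
    apply Finset.sum_congr rfl
    intro i _
    rw [EuclideanSpace.basisFun_apply]
    rw [(hder y hy _).fderiv]; rfl
  obtain ⟨δ, hδ, hδU⟩ := hK.exists_cthickening_subset_open hU hKU
  have hK' : IsCompact (Metric.cthickening δ K) := hK.cthickening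
  have hS : IsCompact (Metric.sphere (0 : EuclideanSpace ℝ (Fin n)) 1) := isCompact_sphere _ _
  have hq : ContinuousOn (fun p : EuclideanSpace ℝ (Fin n) × EuclideanSpace ℝ (Fin n) =>
      fderiv ℝ (fderiv ℝ f) p.1 p.2 p.2) (Metric.cthickening δ K ×ˢ Metric.sphere 0 1) := by
    have c1 : ContinuousOn (fun p : EuclideanSpace ℝ (Fin n) × EuclideanSpace ℝ (Fin n) =>
      fderiv ℝ (fderiv ℝ f) p.1) (Metric.cthickening δ K ×ˢ Metric.sphere 0 1) := 
      (hC0.mono hδU).comp continuousOn_fst (fun p hp => hp.1)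
    exact (c1.clm_apply continuousOn_snd).clm_apply continuousOn_snd
  have huc := (hK'.prod hS).uniformContinuousOn_of_continuous hq
  set κ := η / (2 * n + 1) with hκ
  have hκ0 : 0 < κ := by positivity
  obtain ⟨ε, hε, hu⟩ := Metric.uniformContinuousOn_iff.1 huc κ hκ0
  refine ⟨min δ ε, lt_min hδ hε, ?_⟩
  intro h hh hlt y hy b
  have hmem : ∀ z, ‖z - y‖ ≤ h → z ∈ Metric.cthickening δ K := fun z hz =>
    Metric.mem_cthickening_of_dist_le z y δ K hy (by rw [dist_eq_norm]; exact hz.trans (hlt.le.trans (min_le_left _ _)))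
  have hyy : y ∈ Metric.cthickening δ K := hmem y (by simpa using hh.le)
  have := Finset.sum_le_sum (fun i (_ : i ∈ Finset.univ) => dir_diff f y (b i) (b.orthonormal.1 i)
    (fun z => (fderiv ℝ (fderiv ℝ f) z).flip (b i)) κ h hh
    (fun z hz => hdiff z (hδU (hmem z hz))) (fun z hz => hder z (hδU (hmem z hz)) (b i))
    (fun z hz => by
      have hbi : b i ∈ Metric.sphere (0 : EuclideanSpace ℝ (Fin n)) 1 := by simp
      have := hu (z, b i) ⟨hmem z hz, hbi⟩ (y, b i) ⟨hyy, hbi⟩ (by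
        rw [Prod.dist_eq, dist_self, max_eq_left dist_nonneg, dist_eq_norm]
        exact hz.trans_lt (hlt.trans_le (min_le_right _ _)))
      rw [Real.dist_eq] at this
      exact this.le))
  simp only [ContinuousLinearMap.flip_apply] at this
  refine le_trans ?_ this
  rw [Finset.sum_sub_distrib, ← Finset.mul_sum, htr y (hKU hy) b]
  simp only [mul_zero, zero_sub, Finset.sum_const, Finset.card_univ, Fintype.card_fin, nsmul_eq_mul]
  apply neg_le_neg
  have : (n:ℝ) * (2 * κ) ≤ η := by
    rw [hκ, mul_div_assoc', mul_div_assoc', div_le_iff₀ (by positivity)]; nlinarith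
  nlinarith [sq_nonneg h]

theorem sphere_avg (m : ℕ) (r : ℝ) (hr : 0 < r) {G : Type} [MeasurableSpace G] (μ : Measure G)
    [IsProbabilityMeasure μ]
    (ρ : G → (EuclideanSpace ℝ (Fin (m+1)) ≃ₗᵢ[ℝ] EuclideanSpace ℝ (Fin (m+1))))
    (hρ : Measurable (fun p : G × EuclideanSpace ℝ (Fin (m+1)) => ρ p.1 p.2))
    (hinv : ∀ x y : EuclideanSpace ℝ (Fin (m+1)), ‖x‖ = ‖y‖ → μ.map (fun g => ρ g x) = μ.map (fun g => ρ g y))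
    (F : EuclideanSpace ℝ (Fin (m+1)) → ℝ) (hF : Measurable F) (M : ℝ) (hM : ∀ x, |F x| ≤ M)
    (h0 : ∫ x in Metric.sphere (0 : EuclideanSpace ℝ (Fin (m+1))) r, F x ∂(μH[(m:ℝ)]) = 0)
    (x₀ : EuclideanSpace ℝ (Fin (m+1))) (hx₀ : ‖x₀‖ = r) : ∫ g, F (ρ g x₀) ∂μ = 0 := by
  set S := Metric.sphere (0 : EuclideanSpace ℝ (Fin (m+1))) r with hS
  have hSm : MeasurableSet S := Metric.isClosed_sphere.measurableSet
  set ν : Measure (EuclideanSpace ℝ (Fin (m+1))) := (μH[(m:ℝ)]).restrict S with hν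
  have hfin : IsFiniteMeasure ν := ⟨by rw [hν, Measure.restrict_apply_univ]; exact sphere_fin m r hr⟩
  have hmeas : ∀ x, Measurable (fun g => ρ g x) := fun x => hρ.comp (measurable_id.prodMk measurable_const)
  have hg : ∀ g, ∫ x, F (ρ g x) ∂ν = 0 := by
    intro g
    have hp : MeasurePreserving (ρ g) (μH[(m:ℝ)]) (μH[(m:ℝ)]) :=
      (ρ g).toIsometryEquiv.measurePreserving_hausdorffMeasure _
    have hpre : (ρ g) ⁻¹' S = S := by
      ext x; simp [hS]
    have := hp.setIntegral_preimage_emb (ρ g).toHomeomorph.measurableEmbedding F S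
    rw [hpre] at this
    rw [hν, this, h0]
  have hsw : ∫ g, ∫ x, F (ρ g x) ∂ν ∂μ = ∫ x, ∫ g, F (ρ g x) ∂μ ∂ν := by
    apply integral_integral_swap
    refine Integrable.of_bound (hF.comp hρ).aestronglyMeasurable M (Eventually.of_forall fun p => ?_)
    exact hM _
  simp only [hg, integral_zero] at hsw
  have hconst : ∫ x, ∫ g, F (ρ g x) ∂μ ∂ν = ∫ x, (∫ g, F (ρ g x₀) ∂μ) ∂ν := by
    apply setIntegral_congr_fun hSm
    intro x hx
    simp only
    have hx' : ‖x‖ = ‖x₀‖ := by rw [hx₀]; simpa [hS] using hx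
    have e : ∀ z, ∫ g, F (ρ g z) ∂μ = ∫ y, F y ∂(μ.map (fun g => ρ g z)) := fun z => by
      rw [integral_map (hmeas z).aemeasurable hF.aestronglyMeasurable]
    rw [e, e, hinv x x₀ hx']
  rw [hconst, integral_const, smul_eq_mul] at hsw
  have hpos : 0 < ν.real univ := by
    rw [Measure.real, hν, Measure.restrict_apply_univ]
    exact ENNReal.toReal_pos (sphere_pos m r hr).ne' (sphere_fin m r hr).ne
  rcases mul_eq_zero.1 hsw.symm with h | h
  · exact absurd h hpos.ne'
  · exact h

theorem avg_nonpos (m : ℕ) (r₀ : ℝ) (hr : 0 < r₀) (hr1 : r₀ < 1) {G : Type} [MeasurableSpace G] (μ : Measure G)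
    [IsProbabilityMeasure μ]
    (ρ : G → (EuclideanSpace ℝ (Fin (m+1)) ≃ₗᵢ[ℝ] EuclideanSpace ℝ (Fin (m+1))))
    (hρ : Measurable (fun p : G × EuclideanSpace ℝ (Fin (m+1)) => ρ p.1 p.2))
    (F : EuclideanSpace ℝ (Fin (m+1)) → ℝ) (hF : Measurable F) (M : ℝ) (hM : ∀ x, |F x| ≤ M)
    (hc : ContinuousOn F {x | r₀ ≤ ‖x‖ ∧ ‖x‖ ≤ 1})
    (hh : IsHarmonicOn F {x | r₀ < ‖x‖ ∧ ‖x‖ < 1})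
    (hb : ∀ x, ‖x‖ = r₀ ∨ ‖x‖ = 1 → ∫ g, F (ρ g x) ∂μ = 0)
    (x : EuclideanSpace ℝ (Fin (m+1))) (hx : r₀ ≤ ‖x‖ ∧ ‖x‖ ≤ 1) : ∫ g, F (ρ g x) ∂μ ≤ 0 := by
  set A := {x : EuclideanSpace ℝ (Fin (m+1)) | r₀ ≤ ‖x‖ ∧ ‖x‖ ≤ 1} with hA
  set U := {x : EuclideanSpace ℝ (Fin (m+1)) | r₀ < ‖x‖ ∧ ‖x‖ < 1} with hU
  have hUo : IsOpen U := (isOpen_lt continuous_const continuous_norm).inter (isOpen_lt continuous_norm continuous_const)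
  have hAc : IsCompact A := by
    apply Metric.isCompact_of_isClosed_isBounded
    · exact (isClosed_le continuous_const continuous_norm).inter (isClosed_le continuous_norm continuous_const)
    · refine (Metric.isBounded_closedBall (x := 0) (r := 1)).subset ?_
      intro y hy
      rw [mem_closedBall_zero_iff]; exact hy.2
  have hmeas : ∀ x, Measurable (fun g => ρ g x) := fun x => hρ.comp (measurable_id.prodMk measurable_const)
  have hint : ∀ x, Integrable (fun g => F (ρ g x)) μ := fun x =>
    Integrable.of_bound (hF.comp (hmeas x)).aestronglyMeasurable M (Eventually.of_forall fun p => hM _)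
  set w := fun x => ∫ g, F (ρ g x) ∂μ with hw
  have hρA : ∀ g, ∀ x ∈ A, ρ g x ∈ A := fun g x hx => by
    simp only [hA, mem_ofPred_eq, LinearIsometryEquiv.norm_map]; exact hx
  have hwc : ContinuousOn w A := by
    have huc := hAc.uniformContinuousOn_of_continuous hc
    rw [Metric.uniformContinuousOn_iff] at huc
    rw [Metric.continuousOn_iff]
    intro y hy ε hε
    obtain ⟨δ, hδ, H⟩ := huc (ε/2) (by positivity)
    refine ⟨δ, hδ, fun z hz hzy => ?_⟩
    rw [dist_eq_norm, hw]
    simp only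
    rw [← integral_sub (hint z) (hint y)]
    have := norm_integral_le_of_norm_le_const (μ := μ) (f := fun g => F (ρ g z) - F (ρ g y)) (C := ε/2)
      (Eventually.of_forall fun g => by
        rw [← dist_eq_norm]
        exact (H _ (hρA g z hz) _ (hρA g y hy) (by rw [(ρ g).dist_map]; exact hzy)).le)
    simp at this
    rw [Real.norm_eq_abs]
    linarith
  have key : ∀ ε : ℝ, 0 < ε → w x ≤ ε := by
    intro ε hε
    have hwεc : ContinuousOn (fun y => w y + ε * ‖y‖^2) A := by
      exact hwc.add (by fun_prop)
    obtain ⟨y, hy, hmax⟩ := hAc.exists_isMaxOn ⟨x, hx⟩ hwεc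
    have hyb : ‖y‖ = r₀ ∨ ‖y‖ = 1 := by
      by_contra hcon
      push Not at hcon
      have hyU : y ∈ U := ⟨lt_of_le_of_ne hy.1 (Ne.symm hcon.1), lt_of_le_of_ne hy.2 hcon.2⟩
      have hKU : Metric.sphere (0 : EuclideanSpace ℝ (Fin (m+1))) ‖y‖ ⊆ U := by
        intro z hz
        rw [mem_sphere_zero_iff_norm] at hz
        simp only [hU, mem_ofPred_eq, hz]; exact hyU
      obtain ⟨h0, hh0, H⟩ := second_diff F U (Metric.sphere 0 ‖y‖) hUo hh (isCompact_sphere _ _) hKU ε hε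
      obtain ⟨δ, hδ, hball⟩ := Metric.isOpen_iff.1 hUo y hyU
      set h := min h0 δ / 2 with hhdef
      have hmin : 0 < min h0 δ := lt_min hh0 hδ
      have hpos : 0 < h := by positivity
      have hlt0 : h < h0 := by have := min_le_left h0 δ; linarith
      have hltδ : h < δ := by have := min_le_right h0 δ; linarith
      let e : Fin (m+1) → EuclideanSpace ℝ (Fin (m+1)) := fun i => EuclideanSpace.basisFun (Fin (m+1)) ℝ i
      have hen : ∀ i, ‖e i‖ = 1 := fun i => (EuclideanSpace.basisFun (Fin (m+1)) ℝ).orthonormal.1 i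
      have hUA : U ⊆ A := fun z hz => ⟨hz.1.le, hz.2.le⟩
      have hpA : ∀ i, y + h • e i ∈ A := fun i => hUA (hball (by
        rw [Metric.mem_ball, dist_eq_norm, add_sub_cancel_left, norm_smul, hen, mul_one, Real.norm_eq_abs, abs_of_pos hpos]; exact hltδ))
      have hmA : ∀ i, y - h • e i ∈ A := fun i => hUA (hball (by
        rw [Metric.mem_ball, dist_eq_norm, sub_sub_cancel_left, norm_neg, norm_smul, hen, mul_one, Real.norm_eq_abs, abs_of_pos hpos]; exact hltδ))
      have h1 : ∀ i, w (y + h • e i) + w (y - h • e i) - 2 * w y ≤ - (2 * ε * h^2) := by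
        intro i
        have a1 : w (y + h • e i) + ε * ‖y + h • e i‖^2 ≤ w y + ε * ‖y‖^2 := hmax (hpA i)
        have a2 : w (y - h • e i) + ε * ‖y - h • e i‖^2 ≤ w y + ε * ‖y‖^2 := hmax (hmA i)
        have a3 : ‖y + h • e i‖^2 + ‖y - h • e i‖^2 = 2 * (‖y‖^2 + h^2) := by
          have := parallelogram_law_with_norm ℝ y (h • e i)
          rw [norm_smul, hen, mul_one, Real.norm_eq_abs, abs_of_pos hpos] at this
          linarith
        have : ε * ‖y + h • e i‖^2 + ε * ‖y - h • e i‖^2 = ε * (2 * (‖y‖^2 + h^2)) := by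
          rw [← mul_add, a3]
        linarith
      have h2 : ∑ i, (w (y + h • e i) + w (y - h • e i) - 2 * w y) =
          ∫ g, ∑ i, (F (ρ g y + h • ρ g (e i)) + F (ρ g y - h • ρ g (e i)) - 2 * F (ρ g y)) ∂μ := by
        rw [integral_finsetSum]
        · apply Finset.sum_congr rfl
          intro i _
          simp only [← map_smul, ← map_add, ← map_sub]
          have t1 := integral_sub (f := fun g => F (ρ g (y + h • e i)) + F (ρ g (y - h • e i)))
            ((hint _).add (hint _)) ((hint y).const_mul 2)
          rw [t1, integral_add (hint _) (hint _), integral_const_mul]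
        · intro i _
          simp only [← map_smul, ← map_add, ← map_sub]
          exact ((hint _).add (hint _)).sub ((hint _).const_mul 2)
      have h3 : -(ε * h^2) ≤ ∑ i, (w (y + h • e i) + w (y - h • e i) - 2 * w y) := by
        rw [h2]
        have hc : ∫ _ : G, -(ε * h^2) ∂μ = -(ε * h^2) := by simp
        rw [← hc]
        apply integral_mono (integrable_const _)
        · apply integrable_finsetSum
          intro i _
          simp only [← map_smul, ← map_add, ← map_sub]
          exact ((hint _).add (hint _)).sub ((hint _).const_mul 2)
        · intro g
          have := H h hpos hlt0 (ρ g y) (by simp) ((EuclideanSpace.basisFun (Fin (m+1)) ℝ).map (ρ g))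
          simpa [e] using this
      have h4 := Finset.sum_le_sum (fun i (_ : i ∈ Finset.univ) => h1 i)
      simp only [Finset.sum_const, Finset.card_univ, Fintype.card_fin, nsmul_eq_mul] at h4
      push_cast at h4
      have hm0 : (0:ℝ) ≤ m := Nat.cast_nonneg m
      have hε2 : 0 < ε * h^2 := by positivity
      nlinarith [mul_nonneg hm0 hε2.le]
    have h5 : w x + ε * ‖x‖^2 ≤ w y + ε * ‖y‖^2 := hmax hx
    have h6 : w y = 0 := hb y hyb
    have h7 : ‖y‖^2 ≤ 1 := by have := hy.2; have := norm_nonneg y; nlinarith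
    have : 0 ≤ ε * ‖x‖^2 := by positivity
    nlinarith
  exact le_of_forall_pos_le_add fun ε hε => by simpa using key ε hε

theorem harm_sub {n : ℕ} (u v F : EuclideanSpace ℝ (Fin n) → ℝ) (U : Set (EuclideanSpace ℝ (Fin n)))
    (hU : IsOpen U) (hu : IsHarmonicOn u U) (hv : IsHarmonicOn v U) (hF : ∀ x ∈ U, F x = u x - v x) :
    IsHarmonicOn F U := by
  refine ⟨(hu.1.sub hv.1).congr hF, fun x hx => ?_⟩
  have hd : ∀ f : EuclideanSpace ℝ (Fin n) → ℝ, ContDiffOn ℝ 2 f U → ∀ y ∈ U, DifferentiableAt ℝ f y :=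
    fun f hf y hy => (hf.contDiffAt (hU.mem_nhds hy)).differentiableAt (by norm_num)
  have hd2 : ∀ f : EuclideanSpace ℝ (Fin n) → ℝ, ContDiffOn ℝ 2 f U → ∀ c, ∀ y ∈ U,
      DifferentiableAt ℝ (fun z => fderiv ℝ f z c) y := fun f hf c y hy => by
    have h1 : ContDiffOn ℝ 1 (fderiv ℝ f) U := hf.fderiv_of_isOpen hU (by norm_num)
    exact ((h1.contDiffAt (hU.mem_nhds hy)).differentiableAt (by norm_num)).clm_apply (differentiableAt_const c)
  have h1 : ∀ y ∈ U, fderiv ℝ F y = fderiv ℝ u y - fderiv ℝ v y := by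
    intro y hy
    have : F =ᶠ[nhds y] fun z => u z - v z := by
      filter_upwards [hU.mem_nhds hy] with z hz using hF z hz
    rw [this.fderiv_eq]
    exact fderiv_fun_sub (hd u hu.1 y hy) (hd v hv.1 y hy)
  have h2 : ∀ c, fderiv ℝ (fun y => fderiv ℝ F y c) x c = 
      fderiv ℝ (fun y => fderiv ℝ u y c) x c - fderiv ℝ (fun y => fderiv ℝ v y c) x c := by
    intro c
    have : (fun y => fderiv ℝ F y c) =ᶠ[nhds x] fun z => fderiv ℝ u z c - fderiv ℝ v z c := by
      filter_upwards [hU.mem_nhds hx] with z hz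
      rw [h1 z hz]; rfl
    rw [this.fderiv_eq, fderiv_fun_sub (hd2 u hu.1 c x hx) (hd2 v hv.1 c x hx)]; rfl
  simp only [h2]
  rw [Finset.sum_sub_distrib, hu.2 x hx, hv.2 x hx, sub_zero]

theorem avg_le (m : ℕ) (r₀ : ℝ) (hr : 0 < r₀) (hr1 : r₀ < 1) {G : Type} [MeasurableSpace G] (μ : Measure G)
    [IsProbabilityMeasure μ]
    (ρ : G → (EuclideanSpace ℝ (Fin (m+1)) ≃ₗᵢ[ℝ] EuclideanSpace ℝ (Fin (m+1))))
    (hρ : Measurable (fun p : G × EuclideanSpace ℝ (Fin (m+1)) => ρ p.1 p.2))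
    (hinv : ∀ x y : EuclideanSpace ℝ (Fin (m+1)), ‖x‖ = ‖y‖ → μ.map (fun g => ρ g x) = μ.map (fun g => ρ g y))
    (u v : EuclideanSpace ℝ (Fin (m+1)) → ℝ) 
    (huc : ContinuousOn u {x | r₀ ≤ ‖x‖ ∧ ‖x‖ ≤ 1})
    (hvc : ContinuousOn v {x | r₀ ≤ ‖x‖ ∧ ‖x‖ ≤ 1})
    (hu : IsHarmonicOn u {x | r₀ < ‖x‖ ∧ ‖x‖ < 1})
    (hv : IsHarmonicOn v {x | r₀ < ‖x‖ ∧ ‖x‖ < 1})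
    (h1 : ∫ x in Metric.sphere (0 : EuclideanSpace ℝ (Fin (m+1))) 1, (u x - v x) ∂(μH[(m:ℝ)]) = 0)
    (h0 : ∫ x in Metric.sphere (0 : EuclideanSpace ℝ (Fin (m+1))) r₀, (u x - v x) ∂(μH[(m:ℝ)]) = 0)
    (x : EuclideanSpace ℝ (Fin (m+1))) (hx : r₀ ≤ ‖x‖ ∧ ‖x‖ ≤ 1) : ∫ g, (u (ρ g x) - v (ρ g x)) ∂μ ≤ 0 := by
  set A := {x : EuclideanSpace ℝ (Fin (m+1)) | r₀ ≤ ‖x‖ ∧ ‖x‖ ≤ 1} with hA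
  have hUo : IsOpen {x : EuclideanSpace ℝ (Fin (m+1)) | r₀ < ‖x‖ ∧ ‖x‖ < 1} :=
    (isOpen_lt continuous_const continuous_norm).inter (isOpen_lt continuous_norm continuous_const)
  have hAcl : IsClosed A := 
    (isClosed_le continuous_const continuous_norm).inter (isClosed_le continuous_norm continuous_const)
  have hAc : IsCompact A := by
    apply Metric.isCompact_of_isClosed_isBounded hAcl
    refine (Metric.isBounded_closedBall (x := 0) (r := 1)).subset ?_
    intro y hy
    rw [mem_closedBall_zero_iff]; exact hy.2
  have hsub : ContinuousOn (fun x => u x - v x) A := huc.sub hvc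
  set F := A.indicator (fun x => u x - v x) with hFdef
  have hFA : ∀ y ∈ A, F y = u y - v y := fun y hy => indicator_of_mem hy _
  have hF : Measurable F := by
    classical
    have := hsub.measurable_piecewise (g := fun _ => (0:ℝ)) continuousOn_const hAcl.measurableSet
    rw [hFdef, ← piecewise_eq_indicator]; exact this
  obtain ⟨M, hM⟩ := hAc.exists_bound_of_continuousOn hsub
  have hM' : ∀ y, |F y| ≤ max M 0 := by
    intro y
    by_cases hy : y ∈ A
    · rw [hFA y hy]; exact (hM y hy).trans (le_max_left _ _)
    · rw [hFdef, indicator_of_notMem hy]; simp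
  have hFh := harm_sub u v F _ hUo hu hv (fun y hy => hFA y ⟨hy.1.le, hy.2.le⟩)
  have hsph : ∀ r, r₀ ≤ r → r ≤ 1 → ∫ x in Metric.sphere (0 : EuclideanSpace ℝ (Fin (m+1))) r, (u x - v x) ∂(μH[(m:ℝ)]) = 0 →
      ∫ x in Metric.sphere (0 : EuclideanSpace ℝ (Fin (m+1))) r, F x ∂(μH[(m:ℝ)]) = 0 := by
    intro r a b h
    rw [← h]
    apply setIntegral_congr_fun Metric.isClosed_sphere.measurableSet
    intro y hy
    rw [mem_sphere_zero_iff_norm] at hy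
    exact hFA y (by simp only [hA, mem_ofPred_eq, hy]; exact ⟨a, b⟩)
  have := avg_nonpos m r₀ hr hr1 μ ρ hρ F hF _ hM' (hsub.congr hFA) hFh (fun y hy => by
    rcases hy with hy | hy
    · exact sphere_avg m r₀ hr μ ρ hρ hinv F hF _ hM' (hsph r₀ le_rfl hr1.le h0) y hy
    · exact sphere_avg m 1 one_pos μ ρ hρ hinv F hF _ hM' (hsph 1 hr1.le le_rfl h1) y hy) x hx
  have e : ∀ g, F (ρ g x) = u (ρ g x) - v (ρ g x) := fun g => 
    hFA _ (by simp only [hA, mem_ofPred_eq, LinearIsometryEquiv.norm_map]; exact hx)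
  simpa only [e] using this

theorem main_aux (m : ℕ) (r₀ : ℝ) (hr : 0 < r₀) (hr1 : r₀ < 1)
    (u v : EuclideanSpace ℝ (Fin (m+1)) → ℝ) 
    (huc : ContinuousOn u {x | r₀ ≤ ‖x‖ ∧ ‖x‖ ≤ 1})
    (hvc : ContinuousOn v {x | r₀ ≤ ‖x‖ ∧ ‖x‖ ≤ 1})
    (hu : IsHarmonicOn u {x | r₀ < ‖x‖ ∧ ‖x‖ < 1})
    (hv : IsHarmonicOn v {x | r₀ < ‖x‖ ∧ ‖x‖ < 1})
    (hrad : ∃ g : ℝ → ℝ, ∀ x, v x = g ‖x‖)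
    (h1 : ∫ x in Metric.sphere (0 : EuclideanSpace ℝ (Fin (m+1))) 1, (u x - v x) ∂(μH[(m:ℝ)]) = 0)
    (h0 : ∫ x in Metric.sphere (0 : EuclideanSpace ℝ (Fin (m+1))) r₀, (u x - v x) ∂(μH[(m:ℝ)]) = 0) :
    Lam {x | r₀ < ‖x‖ ∧ ‖x‖ < 1} v ≤ 2 * Lam {x | r₀ < ‖x‖ ∧ ‖x‖ < 1} u := by
  obtain ⟨G, _, μ, ρ, hμ, hρ, hinv⟩ := exists_rot (m+1)
  obtain ⟨g₀, hg₀⟩ := hrad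
  have hvρ : ∀ g x, v (ρ g x) = v x := fun g x => by rw [hg₀, hg₀, LinearIsometryEquiv.norm_map]
  have hmeas : ∀ x, Measurable (fun g => ρ g x) := fun x => hρ.comp (measurable_id.prodMk measurable_const)
  have neg_int : ∀ r, ∫ x in Metric.sphere (0 : EuclideanSpace ℝ (Fin (m+1))) r, (u x - v x) ∂(μH[(m:ℝ)]) = 0 →
      ∫ x in Metric.sphere (0 : EuclideanSpace ℝ (Fin (m+1))) r, (v x - u x) ∂(μH[(m:ℝ)]) = 0 := by
    intro r h
    have h' := congrArg Neg.neg h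
    rw [← integral_neg, neg_zero] at h'
    simpa using h'
  have hzero : ∀ x : EuclideanSpace ℝ (Fin (m+1)), r₀ ≤ ‖x‖ ∧ ‖x‖ ≤ 1 → ∫ g, (u (ρ g x) - v (ρ g x)) ∂μ = 0 := by
    intro x hx
    apply le_antisymm (avg_le m r₀ hr hr1 μ ρ hρ hinv u v huc hvc hu hv h1 h0 x hx)
    have := avg_le m r₀ hr hr1 μ ρ hρ hinv v u hvc huc hv hu (neg_int _ h1) (neg_int _ h0) x hx
    have e : ∫ g, (v (ρ g x) - u (ρ g x)) ∂μ = - ∫ g, (u (ρ g x) - v (ρ g x)) ∂μ := by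
      rw [← integral_neg]; simp
    linarith
  set A := {x : EuclideanSpace ℝ (Fin (m+1)) | r₀ ≤ ‖x‖ ∧ ‖x‖ ≤ 1} with hA
  set Ω := {x : EuclideanSpace ℝ (Fin (m+1)) | r₀ < ‖x‖ ∧ ‖x‖ < 1} with hΩ
  have hΩo : IsOpen Ω :=
    (isOpen_lt continuous_const continuous_norm).inter (isOpen_lt continuous_norm continuous_const)
  have hAcl : IsClosed A := 
    (isClosed_le continuous_const continuous_norm).inter (isClosed_le continuous_norm continuous_const)
  have hΩA : Ω ⊆ A := fun x hx => ⟨hx.1.le, hx.2.le⟩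
  have hAc : IsCompact A := by
    apply Metric.isCompact_of_isClosed_isBounded hAcl
    refine (Metric.isBounded_closedBall (x := 0) (r := 1)).subset ?_
    intro y hy
    rw [mem_closedBall_zero_iff]; exact hy.2
  have hρA : ∀ g x, ρ g x ∈ A ↔ x ∈ A := fun g x => by
    simp only [hA, mem_ofPred_eq, LinearIsometryEquiv.norm_map]
  have hmi : ∀ f : EuclideanSpace ℝ (Fin (m+1)) → ℝ, ContinuousOn f A → Measurable (A.indicator f) := fun f hf => by
    classical
    have := hf.measurable_piecewise (g := fun _ => (0:ℝ)) continuousOn_const hAcl.measurableSet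
    rw [← piecewise_eq_indicator]; exact this
  set U := A.indicator u with hUdef
  set V := A.indicator v with hVdef
  have hUm : Measurable U := hmi u huc
  have hVm : Measurable V := hmi v hvc
  have hVρ : ∀ g x, V (ρ g x) = V x := by
    intro g x
    by_cases hx : x ∈ A
    · rw [hVdef, indicator_of_mem hx, indicator_of_mem ((hρA g x).2 hx), hvρ]
    · rw [hVdef, indicator_of_notMem hx, indicator_of_notMem (fun h => hx ((hρA g x).1 h))]
  obtain ⟨M, hM⟩ := hAc.exists_bound_of_continuousOn huc
  have hfinΩ : IsFiniteMeasure (volume.restrict Ω) :=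
    ⟨by rw [Measure.restrict_apply_univ]; exact (measure_mono hΩA).trans_lt hAc.measure_lt_top⟩
  have hLam : ∀ f : EuclideanSpace ℝ (Fin (m+1)) → ℝ, Measurable (A.indicator f) → Lam Ω f = 
      ∫⁻ l in Ioi (0:ℝ), (volume.restrict Ω) {x | l < |A.indicator f x|} ^ ((1:ℝ)/2) := by
    intro f hf
    unfold Lam
    apply lintegral_congr
    intro l
    rw [Measure.restrict_apply (measurableSet_lt measurable_const (by fun_prop))]
    congr 2
    ext x
    simp only [mem_ofPred_eq, mem_inter_iff]
    constructor
    · rintro ⟨hx, h⟩; rw [indicator_of_mem (hΩA hx)]; exact ⟨h, hx⟩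
    · rintro ⟨h, hx⟩; rw [indicator_of_mem (hΩA hx)] at h; exact ⟨hx, h⟩
  rw [hLam u hUm, hLam v hVm]
  apply lorentz_core (volume.restrict Ω) (fun x => |V x|) (fun x => |U x|) (by fun_prop) (by fun_prop)
    (fun x => abs_nonneg _) (fun x => abs_nonneg _)
  set H := wt (volume.restrict Ω) (fun x => |V x|) with hH
  have hHm : Measurable H := (wt_mono _ _).measurable
  set k : EuclideanSpace ℝ (Fin (m+1)) → ℝ≥0∞ := fun x => ENNReal.ofReal |U x| * H |V x| with hk
  have hkm : Measurable k := by
    have h1 : Measurable fun x => |U x| := by fun_prop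
    have h2 : Measurable fun x => |V x| := by fun_prop
    exact h1.ennreal_ofReal.mul (hHm.comp h2)
  calc ∫⁻ x in Ω, ENNReal.ofReal |V x| * H |V x| 
      ≤ ∫⁻ x in Ω, ∫⁻ g, k (ρ g x) ∂μ := by
        apply setLIntegral_mono' hΩo.measurableSet
        intro x hx
        have hxA := hΩA hx
        simp only [hk, hVρ]
        rw [lintegral_mul_const _ (by have := hUm.comp (hmeas x); exact (measurable_abs.comp this).ennreal_ofReal)]
        gcongr
        have hU2 : ∀ g, U (ρ g x) = u (ρ g x) := fun g => indicator_of_mem ((hρA g x).2 hxA) _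
        have hint : Integrable (fun g => U (ρ g x)) μ :=
          Integrable.of_bound (hUm.comp (hmeas x)).aestronglyMeasurable M (Eventually.of_forall fun g => by
            rw [hU2]; exact hM _ ((hρA g x).2 hxA))
        have hVx : V x = ∫ g, U (ρ g x) ∂μ := by
          have := hzero x hxA
          simp only [hvρ, ← hU2] at this
          rw [integral_sub hint (integrable_const _)] at this
          rw [hVdef, indicator_of_mem hxA]
          simp at this
          linarith
        rw [hVx]
        have := enorm_integral_le_lintegral_enorm (μ := μ) (fun g => U (ρ g x))
        simpa only [Real.enorm_eq_ofReal_abs] using this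
    _ = ∫⁻ g, (∫⁻ x in Ω, k (ρ g x)) ∂μ := by
        apply lintegral_lintegral_swap
        have : Measurable (fun p : EuclideanSpace ℝ (Fin (m+1)) × G => k (ρ p.2 p.1)) := 
          hkm.comp (hρ.comp measurable_swap)
        exact this.aemeasurable
    _ = ∫⁻ g, (∫⁻ x in Ω, k x) ∂μ := by
        apply lintegral_congr
        intro g
        have hp : MeasurePreserving (ρ g) volume volume := (ρ g).measurePreserving
        have hpre : (ρ g) ⁻¹' Ω = Ω := by
          ext x; simp [hΩ]
        have := hp.setLIntegral_comp_preimage hΩo.measurableSet hkm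
        rw [hpre] at this
        exact this
    _ = ∫⁻ x in Ω, k x := by simp

theorem radial_harmonic_L21_minimal (n : ℕ) (hn : 2 ≤ n) :
    ∃ C : ℝ, 0 < C ∧
      ∀ (r₀ : ℝ), 0 < r₀ → r₀ < 1 →
      ∀ u v : EuclideanSpace ℝ (Fin n) → ℝ,
        ContinuousOn u {x | r₀ ≤ ‖x‖ ∧ ‖x‖ ≤ 1} →
        ContinuousOn v {x | r₀ ≤ ‖x‖ ∧ ‖x‖ ≤ 1} →
        IsHarmonicOn u {x | r₀ < ‖x‖ ∧ ‖x‖ < 1} →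
        IsHarmonicOn v {x | r₀ < ‖x‖ ∧ ‖x‖ < 1} →
        (∃ g : ℝ → ℝ, ∀ x, v x = g ‖x‖) →
        (∫ x in Metric.sphere (0 : EuclideanSpace ℝ (Fin n)) 1,
            (u x - v x) ∂(μH[(n : ℝ) - 1])) = 0 →
        (∫ x in Metric.sphere (0 : EuclideanSpace ℝ (Fin n)) r₀,
            (u x - v x) ∂(μH[(n : ℝ) - 1])) = 0 →
        Lam {x | r₀ < ‖x‖ ∧ ‖x‖ < 1} v ≤
          ENNReal.ofReal C * Lam {x | r₀ < ‖x‖ ∧ ‖x‖ < 1} u := by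
  refine ⟨2, two_pos, ?_⟩
  intro r₀ hr hr1 u v huc hvc hu hv hrad h1 h0
  obtain ⟨m, rfl⟩ : ∃ m, n = m + 1 := ⟨n - 1, by omega⟩
  have e : ((m + 1 : ℕ) : ℝ) - 1 = m := by push_cast; ring
  rw [e] at h1 h0
  have := main_aux m r₀ hr hr1 u v huc hvc hu hv hrad h1 h0
  simpa using this
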